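/- Let G be a connected graph with κ̄₄(G) = 1 that has no cut edge. Then G is either a cycle or a cycle together with a single ear. -/

import Mathlib

open SimpleGraph

/-- An `S`-Steiner tree in `G`: a subgraph that is a tree and contains `S`. -/
def SimpleGraph.IsSteinerTree {V : Type*} (G : SimpleGraph V) (S : Set V)
    (T : G.Subgraph) : Prop :=
  S ⊆ T.verts ∧ T.coe.IsTree

/-- `κ(S)`: the maximum number of pairwise internally disjoint `S`-Steiner trees in `G`. -/
noncomputable def SimpleGraph.steinerConn {V : Type*} (G : SimpleGraph V) (S : Set V) : ℕ :=
  sSup {n : ℕ | ∃ f : Fin n → G.Subgraph,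
    (∀ i, G.IsSteinerTree S (f i)) ∧
    ∀ i j, i ≠ j →
      (f i).edgeSet ∩ (f j).edgeSet = ∅ ∧ (f i).verts ∩ (f j).verts = S}

/-- `κ̄ₖ(G) = max {κ(S) : S ⊆ V(G), |S| = k}`, the maximal generalized local connectivity. -/
noncomputable def SimpleGraph.kappaBar {V : Type*} (G : SimpleGraph V) (k : ℕ) : ℕ :=
  sSup {m : ℕ | ∃ S : Finset V, S.card = k ∧ G.steinerConn ↑S = m}

/-- `p` is an ear of the cycle `c` in `G`: a nontrivial path (whose two endpoints may
coincide) meeting `c` exactly in its endpoints. -/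
def SimpleGraph.IsEar {V : Type*} (G : SimpleGraph V) {x u v : V}
    (c : G.Walk x x) (p : G.Walk u v) : Prop :=
  0 < p.length ∧ u ∈ c.support ∧ v ∈ c.support ∧
  p.support.tail.Nodup ∧ (u = v ∨ u ∉ p.support.tail) ∧
  ∀ w ∈ p.support, w ∈ c.support → w = u ∨ w = v

namespace SimpleGraph

variable {V : Type*}

lemma Reachable.of_forall_adj {A A' : SimpleGraph V} (h : ∀ u v, A.Adj u v → A'.Reachable u v)
    {x y : V} (hxy : A.Reachable x y) : A'.Reachable x y := by
  obtain ⟨p⟩ := hxy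
  induction p with
  | nil => exact Reachable.refl _
  | cons e _ ih => exact (h _ _ e).trans ih

lemma Reachable.mem_of_closed {H : SimpleGraph V} {P : V → Prop}
    (h : ∀ u v, H.Adj u v → P u → P v) {x y : V} (hxy : H.Reachable x y) (hx : P x) : P y := by
  obtain ⟨p⟩ := hxy
  induction p with
  | nil => exact hx
  | cons e _ ih => exact ih (h _ _ e hx)

/-- Deletion of all edges of `H` meeting `X`. -/
def avoid (H : SimpleGraph V) (X : Set V) : SimpleGraph V where
  Adj u v := H.Adj u v ∧ u ∉ X ∧ v ∉ X
  symm := ⟨fun _ _ h ↦ ⟨h.1.symm, h.2.2, h.2.1⟩⟩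
  loopless := ⟨fun _ h ↦ h.1.ne rfl⟩

/-- If `X` is attached to its complement only at `a`, walks need not enter `X`. -/
lemma Reachable.avoid {H : SimpleGraph V} {X : Set V} {a : V}
    (ha : ∀ u v, H.Adj u v → u ∉ X → v ∈ X → u = a) {x y : V} (hx : x ∉ X) (hy : y ∉ X)
    (hxy : H.Reachable x y) : (H.avoid X).Reachable x y := by
  have key := hxy.mem_of_closed
    (P := fun v ↦ (v ∉ X → (H.avoid X).Reachable x v) ∧ (v ∈ X → (H.avoid X).Reachable x a))
    (fun u v e hu ↦ ?_) ⟨fun _ ↦ Reachable.refl _, fun h ↦ absurd h hx⟩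
  · exact key.1 hy
  · by_cases huX : u ∈ X <;> by_cases hvX : v ∈ X
    · exact ⟨fun h ↦ absurd hvX h, fun _ ↦ hu.2 huX⟩
    · have := ha _ _ e.symm hvX huX
      exact ⟨fun _ ↦ this ▸ hu.2 huX, fun h ↦ absurd h hvX⟩
    · have := ha _ _ e huX hvX
      exact ⟨fun h ↦ absurd hvX h, fun _ ↦ this ▸ hu.1 huX⟩
    · exact ⟨fun _ ↦ (hu.1 huX).trans (Adj.reachable ⟨e, huX, hvX⟩), fun h ↦ absurd h hvX⟩

/-- A partition of the edges of `G` into two graphs whose edges all lie in the component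
of `r`. -/
structure IsSplitting (G A B : SimpleGraph V) (r : V) : Prop where
  adj_iff : ∀ u v, G.Adj u v ↔ A.Adj u v ∨ B.Adj u v
  disj : ∀ u v, A.Adj u v → ¬ B.Adj u v
  left : ∀ u v, A.Adj u v → A.Reachable r u
  right : ∀ u v, B.Adj u v → B.Reachable r u

/-- The vertices lying in the component of `r` in both graphs. -/
def shared (A B : SimpleGraph V) (r : V) : Set V := {v | A.Reachable r v ∧ B.Reachable r v}

lemma shared_comm (A B : SimpleGraph V) (r : V) : shared A B r = shared B A r := by
  ext v; exact and_comm

lemma IsSplitting.swap {G A B : SimpleGraph V} {r : V} (h : G.IsSplitting A B r) :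
    G.IsSplitting B A r :=
  ⟨fun u v ↦ (h.adj_iff u v).trans or_comm, fun u v hb ha ↦ h.disj u v ha hb, h.right, h.left⟩

lemma ncard_shared_lt [Finite V] {A B A' B' : SimpleGraph V} {r v : V}
    (hA : ∀ u, A.Reachable r u → A'.Reachable r u) (hB : ∀ u, B.Reachable r u → B'.Reachable r u)
    (hv : v ∉ shared A B r) (hv' : v ∈ shared A' B' r) :
    (shared A B r).ncard < (shared A' B' r).ncard := by
  refine Set.ncard_lt_ncard ?_ (Set.toFinite _)
  exact ⟨fun u hu ↦ ⟨hA u hu.1, hB u hu.2⟩, fun h ↦ hv (h hv')⟩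

/-- A non-bridge of `A` leaving the component of `r` in `B` can be moved to `B`. -/
lemma IsSplitting.exists_lt_of_boundary [Finite V] {G A B : SimpleGraph V} {r a b : V}
    (h : G.IsSplitting A B r) (hab : A.Adj a b) (hbr : ¬ A.IsBridge s(a, b))
    (ha : B.Reachable r a) (hb : ¬ B.Reachable r b) :
    ∃ A' B', G.IsSplitting A' B' r ∧ (shared A B r).ncard < (shared A' B' r).ncard := by
  rw [isBridge_iff, not_not] at hbr
  set A' := A.deleteEdges {s(a, b)} with hA'
  set B' := B ⊔ fromEdgeSet {s(a, b)} with hB'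
  have rA : ∀ {u v}, A.Reachable u v → A'.Reachable u v := fun {u v} huv ↦
    huv.of_forall_adj fun u v e ↦ by
      by_cases hs : s(u, v) = s(a, b)
      · rcases Sym2.eq_iff.1 hs with ⟨rfl, rfl⟩ | ⟨rfl, rfl⟩
        exacts [hbr, hbr.symm]
      · exact Adj.reachable (by simp [hA', e, hs])
  have rB : ∀ {u v}, B.Reachable u v → B'.Reachable u v := fun {u v} huv ↦ huv.mono le_sup_left
  have eB : B'.Adj a b := by simp [hB', hab.ne]
  refine ⟨A', B', ⟨fun u v ↦ ?_, fun u v hA hB ↦ ?_, fun u v e ↦ ?_, fun u v e ↦ ?_⟩, ?_⟩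
  · have := h.adj_iff u v
    have h2 : s(u, v) = s(a, b) → A.Adj u v := fun hs ↦ by
      rwa [← mem_edgeSet, hs, mem_edgeSet]
    simp only [hA', hB', deleteEdges_adj, sup_adj, fromEdgeSet_adj, Set.mem_singleton_iff]
    by_cases hs : s(u, v) = s(a, b)
    · have := h2 hs
      have := this.ne
      tauto
    · tauto
  · simp only [hA', hB', deleteEdges_adj, sup_adj, fromEdgeSet_adj, Set.mem_singleton_iff]
      at hA hB
    exact hB.elim (h.disj u v hA.1) fun h ↦ hA.2 h.1
  · exact rA (h.left u v (deleteEdges_le _ e))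
  · rcases e with e | e
    · exact rB (h.right u v e)
    · rcases Sym2.eq_iff.1 ((fromEdgeSet_adj _).1 e).1 with ⟨rfl, rfl⟩ | ⟨rfl, rfl⟩
      · exact rB ha
      · exact (rB ha).trans eB.reachable
  · exact ncard_shared_lt (v := b) (fun u ↦ rA) (fun u ↦ rB) (fun h ↦ hb h.2)
      ⟨rA ((h.left _ _ hab).trans hab.reachable), (rB ha).trans eB.reachable⟩

/-- A triangle of `A` carrying all shared vertices allows an exchange of two edges. -/
lemma IsSplitting.exists_lt_of_triangle [Finite V] {G A B : SimpleGraph V} {r x y z : V}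
    (h : G.IsSplitting A B r) (hxy : A.Adj x y) (hyz : A.Adj y z) (hzx : A.Adj z x)
    (hx : B.Reachable r x) (hy : B.Reachable r y)
    (hS : shared A B r ⊆ {x, y, z}) :
    ∃ A' B', G.IsSplitting A' B' r ∧ (shared A B r).ncard < (shared A' B' r).ncard := by
  classical
  obtain ⟨p, hp⟩ := (hx.symm.trans hy).exists_isPath
  cases p with
  | nil => exact absurd rfl hxy.ne
  | @cons _ w _ hxw p =>
  rw [Walk.cons_isPath_iff] at hp
  have hwB : B.Reachable r w := hx.trans hxw.reachable
  have hwA : ¬ A.Reachable r w := fun hw ↦ by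
    rcases hS (show w ∈ shared A B r from ⟨hw, hwB⟩) with rfl | rfl | rfl
    · exact hxw.ne rfl
    · exact h.disj _ _ hxy hxw
    · exact h.disj _ _ hzx hxw.symm
  have hAxw : ¬ A.Adj x w := fun e ↦ hwA (h.left _ _ e.symm)
  have hBxy : ¬ B.Adj x y := h.disj _ _ hxy
  have hne : s(x, w) ≠ s(x, y) := fun hs ↦ by
    rw [← mem_edgeSet, hs, mem_edgeSet] at hxw; exact hBxy hxw
  set A' := A.deleteEdges {s(x, y)} ⊔ fromEdgeSet {s(x, w)} with hA'
  set B' := B.deleteEdges {s(x, w)} ⊔ fromEdgeSet {s(x, y)} with hB'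
  have eA : A'.Adj x w := by simp [hA', hxw.ne]
  have eB : B'.Adj x y := by simp [hB', hxy.ne]
  have rA : ∀ {u v}, A.Reachable u v → A'.Reachable u v := fun {u v} huv ↦
    huv.of_forall_adj fun u v e ↦ by
      have key : A'.Reachable x y := by
        have e1 : A'.Adj x z := Or.inl (by
          simp only [deleteEdges_adj, hzx.symm, Set.mem_singleton_iff, true_and, Sym2.eq_iff]
          grind [hxy.ne, hyz.ne, hzx.ne])
        have e2 : A'.Adj z y := Or.inl (by
          simp only [deleteEdges_adj, hyz.symm, Set.mem_singleton_iff, true_and, Sym2.eq_iff]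
          grind [hxy.ne, hyz.ne, hzx.ne])
        exact e1.reachable.trans e2.reachable
      by_cases hs : s(u, v) = s(x, y)
      · rcases Sym2.eq_iff.1 hs with ⟨rfl, rfl⟩ | ⟨rfl, rfl⟩
        exacts [key, key.symm]
      · exact Adj.reachable (Or.inl (by simp [e, hs]))
  have rB : ∀ {u v}, B.Reachable u v → B'.Reachable u v := fun {u v} huv ↦
    huv.of_forall_adj fun u v e ↦ by
      have key : B'.Reachable x w := by
        refine eB.reachable.trans ((p.transfer B' fun e he ↦ ?_).reachable.symm)
        rw [hB', edgeSet_sup, edgeSet_deleteEdges]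
        refine Or.inl ⟨p.edges_subset_edgeSet he, fun hs ↦ hp.2 ?_⟩
        rw [Set.mem_singleton_iff.1 hs] at he
        exact p.fst_mem_support_of_mem_edges he
      by_cases hs : s(u, v) = s(x, w)
      · rcases Sym2.eq_iff.1 hs with ⟨rfl, rfl⟩ | ⟨rfl, rfl⟩
        exacts [key, key.symm]
      · exact Adj.reachable (Or.inl (by simp [e, hs]))
  have rxA : A.Reachable r x := h.left _ _ hxy
  refine ⟨A', B', ⟨fun u v ↦ ?_, fun u v hA hB ↦ ?_, fun u v e ↦ ?_, fun u v e ↦ ?_⟩, ?_⟩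
  · have := h.adj_iff u v
    have h1 : s(u, v) = s(x, y) → A.Adj u v := fun hs ↦ by
      rwa [← mem_edgeSet, hs, mem_edgeSet]
    have h2 : s(u, v) = s(x, w) → B.Adj u v := fun hs ↦ by
      rwa [← mem_edgeSet, hs, mem_edgeSet]
    simp only [hA', hB', deleteEdges_adj, sup_adj, fromEdgeSet_adj, Set.mem_singleton_iff]
    have hn : A.Adj u v → u ≠ v := Adj.ne
    have hn' : B.Adj u v → u ≠ v := Adj.ne
    tauto
  · have h1 : s(u, v) = s(x, w) → ¬ A.Adj u v := fun hs ↦ by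
      rwa [← mem_edgeSet, hs, mem_edgeSet]
    have h2 : s(u, v) = s(x, y) → ¬ B.Adj u v := fun hs ↦ by
      rwa [← mem_edgeSet, hs, mem_edgeSet]
    simp only [hA', hB', deleteEdges_adj, sup_adj, fromEdgeSet_adj, Set.mem_singleton_iff]
      at hA hB
    have := h.disj u v
    rcases hA with hA | hA <;> rcases hB with hB | hB
    · tauto
    · tauto
    · tauto
    · exact hne (hA.1.symm.trans hB.1)
  · rcases e with e | e
    · exact rA (h.left u v (deleteEdges_le _ e))
    · rcases Sym2.eq_iff.1 ((fromEdgeSet_adj _).1 e).1 with ⟨rfl, rfl⟩ | ⟨rfl, rfl⟩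
      · exact rA rxA
      · exact (rA rxA).trans eA.reachable
  · rcases e with e | e
    · exact rB (h.right u v (deleteEdges_le _ e))
    · rcases Sym2.eq_iff.1 ((fromEdgeSet_adj _).1 e).1 with ⟨rfl, rfl⟩ | ⟨rfl, rfl⟩
      · exact rB hx
      · exact rB hy
  · exact ncard_shared_lt (v := w) (fun u ↦ rA) (fun u ↦ rB) (fun h ↦ hwA h.1)
      ⟨(rA rxA).trans eA.reachable, rB hwB⟩

lemma _root_.List.ncard_setOf_mem {α : Type*} {l : List α} (hl : l.Nodup) :
    {a | a ∈ l}.ncard = l.length := by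
  classical
  rw [← List.coe_toFinset, Set.ncard_coe_finset, List.toFinset_card_of_nodup hl]

/-- If a non-bridge of `A` avoids the component of `r` in `B`, a branch of `A` hanging on a
bridge and containing a single shared vertex can be moved to `B`. -/
lemma IsSplitting.exists_smaller [Finite V] {G A B : SimpleGraph V} {r x y : V}
    (h : G.IsSplitting A B r) (hG : G.Connected) (hb : ∀ e, ¬ G.IsBridge e)
    (hxy : A.Adj x y) (hbr : ¬ A.IsBridge s(x, y)) (hx : ¬ B.Reachable r x)
    (hcl : ∀ a b, A.Adj a b → ¬ A.IsBridge s(a, b) → B.Reachable r a → B.Reachable r b)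
    (h3 : (shared A B r).ncard ≤ 3) :
    ∃ A' B' a, G.IsSplitting A' B' a ∧ (shared A B r).ncard ≤ (shared A' B' a).ncard ∧
      A'.edgeSet.ncard < A.edgeSet.ncard ∧ A'.Adj x y ∧ ¬ A'.IsBridge s(x, y) := by
  set Y : Set V := {v | (A.avoid {w | B.Reachable r w}).Reachable x v} with hY
  have hYB : ∀ v ∈ Y, ¬ B.Reachable r v := fun v hv ↦
    Reachable.mem_of_closed (H := A.avoid {w | B.Reachable r w}) (P := fun v ↦ ¬ B.Reachable r v)
      (fun _ _ e _ ↦ e.2.2) hv hx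
  have hxY : x ∈ Y := Reachable.refl _
  have bd : ∀ a b, G.Adj a b → a ∈ Y → b ∉ Y →
      A.Adj a b ∧ B.Reachable r b ∧ A.IsBridge s(a, b) := by
    intro a b e ha hbY
    have e' : A.Adj a b := ((h.adj_iff a b).1 e).resolve_right fun e ↦ hYB a ha (h.right _ _ e)
    have hbB : B.Reachable r b := by
      by_contra hbB
      exact hbY (Reachable.trans ha (Adj.reachable ⟨e', hYB a ha, hbB⟩))
    refine ⟨e', hbB, ?_⟩
    by_contra hn
    exact hYB a ha (hcl b a e'.symm (by rwa [Sym2.eq_swap]) hbB)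
  set X : V → V → Set V := fun a b ↦ {v | (A.deleteEdges {s(a, b)}).Reachable b v} with hX
  have hYX : ∀ a b, G.Adj a b → a ∈ Y → b ∉ Y → ∀ v ∈ Y, v ∉ X a b := by
    intro a b e ha hbY v hv hvX
    obtain ⟨-, hbB, hbri⟩ := bd a b e ha hbY
    have hle : A.avoid {w | B.Reachable r w} ≤ A.deleteEdges {s(a, b)} := by
      intro u w euw
      simp only [deleteEdges_adj, Set.mem_singleton_iff]
      refine ⟨euw.1, fun hs ↦ ?_⟩
      rcases Sym2.eq_iff.1 hs with ⟨rfl, rfl⟩ | ⟨rfl, rfl⟩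
      exacts [euw.2.2 hbB, euw.2.1 hbB]
    have := ((Reachable.symm ha).trans hv).mono hle
    exact isBridge_iff.1 hbri (this.trans (Reachable.symm hvX))
  have hbX : ∀ a b a' b', G.Adj a b → a ∈ Y → b ∉ Y → G.Adj a' b' → a' ∈ Y → b' ∉ Y →
      s(a', b') ≠ s(a, b) → b' ∉ X a b := by
    intro a b a' b' e ha hbY e' ha' hbY' hne hb'
    refine hYX a b e ha hbY a' ha' (Reachable.trans hb' (Adj.reachable ?_))
    simp [(bd _ _ e' ha' hbY').1.symm, Sym2.eq_swap, hne]
  have hdisj : ∀ a b a' b', G.Adj a b → a ∈ Y → b ∉ Y → G.Adj a' b' → a' ∈ Y → b' ∉ Y →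
      s(a', b') ≠ s(a, b) → Disjoint (X a b) (X a' b') := by
    intro a b a' b' e ha hbY e' ha' hbY' hne
    rw [Set.disjoint_left]
    intro v hv
    refine (hv.mem_of_closed (P := fun v ↦ v ∈ X a b ∧ v ∉ X a' b') ?_
      ⟨Reachable.refl _, hbX a' b' a b e' ha' hbY' e ha hbY hne.symm⟩).2
    rintro u v euv ⟨hu, hu'⟩
    have hvX : v ∈ X a b := Reachable.trans hu euv.reachable
    refine ⟨hvX, fun hv' ↦ hu' (Reachable.trans hv' (Adj.reachable ?_))⟩
    have := hYX a b e ha hbY a' ha'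
    simp only [deleteEdges_adj, Set.mem_singleton_iff]
    refine ⟨(deleteEdges_le _ euv.symm), fun hs ↦ ?_⟩
    rcases Sym2.eq_iff.1 hs with ⟨rfl, rfl⟩ | ⟨rfl, rfl⟩
    exacts [this hvX, this hu]
  obtain ⟨a₀, b₀, e₀, ha₀, hb₀⟩ : ∃ a b, G.Adj a b ∧ a ∈ Y ∧ b ∉ Y := by
    by_contra! hn
    exact hYB r ((hG.preconnected x r).mem_of_closed (fun u v e hu ↦ hn u v e hu) hxY)
      (Reachable.refl _)
  obtain ⟨a₁, b₁, e₁, ha₁, hb₁, hne⟩ :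
      ∃ a b, G.Adj a b ∧ a ∈ Y ∧ b ∉ Y ∧ s(a, b) ≠ s(a₀, b₀) := by
    by_contra! hn
    have := hb s(a₀, b₀)
    rw [isBridge_iff, not_not] at this
    refine hb₀ (this.mem_of_closed (fun u v e hu ↦ ?_) ha₀)
    by_contra hv
    rw [deleteEdges_adj] at e
    exact e.2 (hn u v e.1 hu hv)
  have mem : ∀ a b, G.Adj a b → a ∈ Y → b ∉ Y → b ∈ shared A B r ∩ X a b := by
    intro a b e ha hbY
    obtain ⟨eA, hbB, -⟩ := bd a b e ha hbY
    exact ⟨⟨h.left _ _ eA.symm, hbB⟩, Reachable.refl _⟩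
  obtain ⟨a, b, e, ha, hbY, hS⟩ :
      ∃ a b, G.Adj a b ∧ a ∈ Y ∧ b ∉ Y ∧ (shared A B r ∩ X a b).ncard ≤ 1 := by
    by_contra! hn
    have h0 := hn a₀ b₀ e₀ ha₀ hb₀
    have h1 := hn a₁ b₁ e₁ ha₁ hb₁
    have hd : Disjoint (shared A B r ∩ X a₀ b₀) (shared A B r ∩ X a₁ b₁) :=
      (hdisj a₀ b₀ a₁ b₁ e₀ ha₀ hb₀ e₁ ha₁ hb₁ hne).mono Set.inter_subset_right
        Set.inter_subset_right
    have := Set.ncard_union_eq hd (Set.toFinite _) (Set.toFinite _)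
    have := Set.ncard_le_ncard (Set.union_subset (Set.inter_subset_left (t := X a₀ b₀))
      (Set.inter_subset_left (t := X a₁ b₁))) (Set.toFinite (shared A B r))
    omega
  have hbS := mem a b e ha hbY
  have hS' : ∀ v ∈ shared A B r, v ≠ b → v ∉ X a b := fun v hv hvb hvX ↦
    hvb (Set.ncard_le_one (Set.toFinite _) |>.1 hS v ⟨hv, hvX⟩ b hbS)
  obtain ⟨eA, hbB, hbri⟩ := bd a b e ha hbY
  have haX : a ∉ X a b := hYX a b e ha hbY a ha
  have hxX : x ∉ X a b := hYX a b e ha hbY x hxY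
  have hedge : ∀ u v, A.Adj u v → u ∉ X a b → v ∈ X a b → s(u, v) = s(a, b) := by
    intro u v euv hu hv
    by_contra hs
    refine hu (Reachable.trans hv (Adj.reachable ?_))
    simp [euv.symm, Sym2.eq_swap, hs]
  have hedge' : ∀ u v, A.Adj u v → u ∉ X a b → v ∈ X a b → u = a := by
    intro u v euv hu hv
    rcases Sym2.eq_iff.1 (hedge u v euv hu hv) with ⟨h, -⟩ | ⟨rfl, -⟩
    exacts [h, absurd hbS.2 hu]
  set A' := A.avoid (X a b) with hA'
  have hA'A : A' ≤ A := fun _ _ e ↦ e.1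
  have hAG : A ≤ G := fun u v e ↦ (h.adj_iff u v).2 (Or.inl e)
  have hBB' : B ≤ G \ A' := fun u v e ↦
    ⟨(h.adj_iff u v).2 (Or.inr e), fun e' ↦ h.disj u v e'.1 e⟩
  have hab' : (G \ A').Adj a b := ⟨e, fun e' ↦ e'.2.2 hbS.2⟩
  have rA : ∀ v, A.Reachable r v → v ∉ X a b → A'.Reachable a v := fun v hv hvX ↦
    Reachable.avoid hedge' haX hvX ((h.left _ _ eA).symm.trans hv)
  have rB : ∀ v, B.Reachable r v → (G \ A').Reachable a v := fun v hv ↦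
    hab'.reachable.trans ((hbB.symm.trans hv).mono hBB')
  have rX : ∀ v ∈ X a b, (G \ A').Reachable a v := by
    intro v hv
    refine (hv.mem_of_closed (P := fun v ↦ v ∈ X a b ∧ (G \ A').Reachable a v) ?_
      ⟨hbS.2, hab'.reachable⟩).2
    rintro u v euv ⟨hu, hu'⟩
    exact ⟨Reachable.trans hu euv.reachable, hu'.trans
      (Adj.reachable ⟨hAG (deleteEdges_le _ euv), fun e' ↦ e'.2.1 hu⟩)⟩
  have hyX : y ∉ X a b := fun hy ↦ hbr (hedge x y hxy hxX hy ▸ hbri)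
  refine ⟨A', G \ A', a, ⟨fun u v ↦ ?_, fun u v e e' ↦ e'.2 e,
    fun u v e ↦ rA u (h.left _ _ e.1) e.2.1, fun u v e ↦ ?_⟩, ?_, ?_, ⟨hxy, hxX, hyX⟩, ?_⟩
  · have : A'.Adj u v → G.Adj u v := fun e ↦ hAG (hA'A e)
    rw [sdiff_adj]; tauto
  · rcases (h.adj_iff u v).1 e.1 with e' | e'
    · by_cases hu : u ∈ X a b
      · exact rX u hu
      · by_cases hv : v ∈ X a b
        · rw [hedge' u v e' hu hv]
        · exact absurd ⟨e', hu, hv⟩ e.2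
    · exact rB u (h.right _ _ e')
  · have hsub : insert a (shared A B r \ {b}) ⊆ shared A' (G \ A') a := by
      rintro v (rfl | ⟨hv, hvb⟩)
      · exact ⟨Reachable.refl _, Reachable.refl _⟩
      · exact ⟨rA v hv.1 (hS' v hv hvb), rB v hv.2⟩
    refine le_trans (le_of_eq ?_) (Set.ncard_le_ncard hsub (Set.toFinite _))
    rw [Set.ncard_insert_of_notMem (fun h ↦ hYB a ha h.1.2),
      Set.ncard_sdiff_singleton_add_one hbS.1]
  · refine Set.ncard_lt_ncard ⟨edgeSet_mono hA'A, fun hle ↦ ?_⟩ (Set.toFinite _)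
    exact haX.elim (((hle (show s(a, b) ∈ A.edgeSet from eA) : A'.Adj a b)).2.2 hbS.2).elim
  · rw [isBridge_iff, not_not] at hbr ⊢
    refine (hbr.avoid (a := a) (fun u v e ↦ hedge' u v (deleteEdges_le _ e)) hxX hyX).mono ?_
    intro u v e
    have := e.1
    rw [deleteEdges_adj] at this ⊢
    exact ⟨⟨this.1, e.2⟩, this.2⟩

lemma IsSplitting.exists_lt_of_not_isBridge [Finite V] {G : SimpleGraph V}
    (hG : G.Connected) (hb : ∀ e, ¬ G.IsBridge e) {A B : SimpleGraph V} {r x y : V}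
    (h : G.IsSplitting A B r) (hxy : A.Adj x y) (hbr : ¬ A.IsBridge s(x, y))
    (h3 : (shared A B r).ncard ≤ 3) :
    ∃ A' B' r', G.IsSplitting A' B' r' ∧ (shared A B r).ncard < (shared A' B' r').ncard := by
  classical
  induction hn : A.edgeSet.ncard using Nat.strong_induction_on generalizing A B r with
  | _ n ih =>
  subst hn
  by_cases hcl : ∀ a b, A.Adj a b → ¬ A.IsBridge s(a, b) → B.Reachable r a → B.Reachable r b
  swap
  · push Not at hcl
    obtain ⟨a, b, hab, hbr', ha, hb'⟩ := hcl
    obtain ⟨A', B', h', hlt⟩ := h.exists_lt_of_boundary hab hbr' ha hb'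
    exact ⟨A', B', r, h', hlt⟩
  by_cases hx : B.Reachable r x
  · obtain ⟨u, c, hc, hce⟩ :=
      (adj_and_reachable_delete_edges_iff_exists_cycle (v := x) (w := y)).1
        ⟨hxy, not_not.1 hbr⟩
    have hedge : ∀ a b, s(a, b) ∈ c.edges → (B.Reachable r a → B.Reachable r b) := by
      intro a b hab
      refine hcl a b (c.adj_of_mem_edges hab) fun h ↦ h.notMem_edges_of_isCycle hc hab
    have hprop : ∀ {p q : V} (w : A.Walk p q), (∀ e ∈ w.edges, e ∈ c.edges) →
        B.Reachable r p → ∀ v ∈ w.support, B.Reachable r v := by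
      intro p q w
      induction w with
      | nil => simp
      | @cons p' q' r' e w ih =>
        intro hw hp v hv
        rw [Walk.edges_cons] at hw
        rw [Walk.support_cons, List.mem_cons] at hv
        rcases hv with rfl | hv
        · exact hp
        · exact ih (fun e he ↦ hw e (List.mem_cons_of_mem _ he))
            (hedge _ _ (hw _ List.mem_cons_self) hp) v hv
    have hxc : x ∈ c.support := c.fst_mem_support_of_mem_edges hce
    set d := c.rotate x hxc with hd
    have hdc : d.IsCycle := hc.rotate hxc
    have hdB : ∀ v ∈ d.support, B.Reachable r v :=
      hprop d (fun e he ↦ ((c.rotate_edges x hxc).perm.mem_iff).1 he) hx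
    have hrx : A.Reachable r x := h.left _ _ hxy
    have hsub : {v | v ∈ d.support.tail} ⊆ shared A B r := fun v hv ↦
      ⟨hrx.trans (d.takeUntil v (List.mem_of_mem_tail hv)).reachable,
        hdB v (List.mem_of_mem_tail hv)⟩
    have hcard : {v | v ∈ d.support.tail}.ncard = d.length := by
      simp [List.ncard_setOf_mem hdc.support_nodup]
    have hle := Set.ncard_le_ncard hsub (Set.toFinite _)
    have hlen : d.length = 3 := le_antisymm (by omega) hdc.three_le_length
    have hSeq := Set.eq_of_subset_of_ncard_le hsub (by omega) (Set.toFinite _)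
    clear_value d
    match d, hlen with
    | .cons h1 (.cons h2 (.cons h3 .nil)), _ =>
      rename_i p q
      obtain ⟨A', B', h', hlt⟩ := h.exists_lt_of_triangle h1 h2 h3 (hdB _ (by simp))
        (hdB _ (by simp)) (by rw [← hSeq]; intro v; simp; tauto)
      exact ⟨A', B', r, h', hlt⟩
  · obtain ⟨A', B', a, h', hle, hlt, hxy', hbr'⟩ := h.exists_smaller hG hb hxy hbr hx hcl h3
    by_cases heq : (shared A' B' a).ncard ≤ 3
    · obtain ⟨A'', B'', r', h'', hl⟩ := ih _ hlt h' hxy' hbr' heq rfl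
      exact ⟨A'', B'', r', h'', hle.trans_lt hl⟩
    · exact ⟨A', B', a, h', by omega⟩

lemma IsAcyclic.ncard_edgeSet_add_one_le [Finite V] {A : SimpleGraph V} {r : V} (hA : A.IsAcyclic)
    (hr : ∀ u v, A.Adj u v → A.Reachable r u) :
    A.edgeSet.ncard + 1 ≤ {v | A.Reachable r v}.ncard := by
  classical
  have := Fintype.ofFinite V
  set c := A.connectedComponentMk r with hc
  have ht := hA.isTree_connectedComponent c
  have hcard := ht.card_edgeFinset
  have hsupp : {v | A.Reachable r v} = c.supp := by
    ext v
    simp only [Set.mem_ofPred_eq, ConnectedComponent.mem_supp_iff, hc, ConnectedComponent.eq]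
    exact ⟨Reachable.symm, Reachable.symm⟩
  have hsub : A.edgeSet ⊆ Sym2.map Subtype.val '' c.toSimpleGraph.edgeSet := by
    intro e
    induction e with | _ u v
    intro e
    have hu : u ∈ c.supp := hsupp ▸ hr u v e
    have hv : v ∈ c.supp := hsupp ▸ hr v u e.symm
    exact ⟨s(⟨u, hu⟩, ⟨v, hv⟩), e, rfl⟩
  have h1 := Set.ncard_le_ncard hsub (Set.toFinite _)
  have h2 := Set.ncard_image_le (f := Sym2.map Subtype.val) (Set.toFinite c.toSimpleGraph.edgeSet)
  have h4 : c.toSimpleGraph.edgeSet.ncard = c.toSimpleGraph.edgeFinset.card := by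
    rw [← coe_edgeFinset, Set.ncard_coe_finset]
  have h5 := Nat.card_coe_set_eq c.supp
  rw [hsupp]
  rw [← Nat.card_eq_fintype_card] at hcard
  have h3 : Nat.card c = Nat.card c.supp := rfl
  omega

lemma IsSplitting.ncard_edgeSet_add_two_le [Finite V] {G A B : SimpleGraph V} {r : V}
    (h : G.IsSplitting A B r) (hA : A.IsAcyclic) (hB : B.IsAcyclic) :
    G.edgeSet.ncard + 2 ≤ Nat.card V + (shared A B r).ncard := by
  have h1 := hA.ncard_edgeSet_add_one_le h.left
  have h2 := hB.ncard_edgeSet_add_one_le h.right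
  have h3 : G.edgeSet = A.edgeSet ∪ B.edgeSet := by
    ext e
    induction e with | _ u v
    exact h.adj_iff u v
  have h4 := Set.ncard_union_le A.edgeSet B.edgeSet
  have h5 := Set.ncard_union_add_ncard_inter {v | A.Reachable r v} {v | B.Reachable r v}
  have h6 : {v | A.Reachable r v} ∩ {v | B.Reachable r v} = shared A B r := rfl
  have h7 := Set.ncard_le_card ({v | A.Reachable r v} ∪ {v | B.Reachable r v})
  rw [h3]
  rw [h6] at h5
  omega

/-- Some splitting of a bridgeless graph of cyclomatic number at least three has four shared
vertices. -/
lemma Connected.exists_isSplitting [Finite V] {G : SimpleGraph V} (hG : G.Connected)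
    (hb : ∀ e, ¬ G.IsBridge e) (hE : Nat.card V + 2 ≤ G.edgeSet.ncard) :
    ∃ A B r, G.IsSplitting A B r ∧ 4 ≤ (shared A B r).ncard := by
  have key : ∀ k ≤ 4, ∃ A B r, G.IsSplitting A B r ∧ k ≤ (shared A B r).ncard := by
    intro k hk
    induction k with
    | zero =>
      obtain ⟨r⟩ := hG.nonempty
      exact ⟨G, ⊥, r, ⟨by simp, by simp, fun u _ _ ↦ hG.preconnected r u, by simp⟩, by simp⟩
    | succ k ih =>
      obtain ⟨A, B, r, h, hle⟩ := ih (by omega)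
      by_cases h3 : k < (shared A B r).ncard
      · exact ⟨A, B, r, h, h3⟩
      have hcount := h.ncard_edgeSet_add_two_le
      by_cases hA : A.IsAcyclic
      · by_cases hB : B.IsAcyclic
        · have := hcount hA hB
          omega
        · simp only [isAcyclic_iff_forall_adj_isBridge, not_forall] at hB
          obtain ⟨x, y, hxy, hbr⟩ := hB
          obtain ⟨A', B', r', h', hlt⟩ :=
            h.swap.exists_lt_of_not_isBridge hG hb hxy hbr (by rw [shared_comm]; omega)
          rw [shared_comm] at hlt
          exact ⟨A', B', r', h', by omega⟩
      · simp only [isAcyclic_iff_forall_adj_isBridge, not_forall] at hA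
        obtain ⟨x, y, hxy, hbr⟩ := hA
        obtain ⟨A', B', r', h', hlt⟩ := h.exists_lt_of_not_isBridge hG hb hxy hbr (by omega)
        exact ⟨A', B', r', h', by omega⟩
  exact key 4 le_rfl

/-- A connected induced subgraph can be shrunk, keeping it connected, until it meets `W` in
exactly `k` vertices. -/
lemma exists_connected_induce_ncard_inter_eq [Finite V] {A : SimpleGraph V} {k : ℕ} (hk : 0 < k)
    {X W : Set V} (hX : (A.induce X).Connected) (hc : k ≤ (X ∩ W).ncard) :
    ∃ X', (A.induce X').Connected ∧ (X' ∩ W).ncard = k := by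
  induction hn : X.ncard using Nat.strong_induction_on generalizing X with
  | _ n ih =>
  subst hn
  rcases hc.eq_or_lt with hc | hc
  · exact ⟨X, hX, hc.symm⟩
  have hXc : 1 < X.ncard := by
    have := Set.ncard_le_ncard (Set.inter_subset_left (s := X) (t := W)) (Set.toFinite _)
    omega
  have : Nontrivial X := Set.nontrivial_coe_sort.2 ((Set.one_lt_ncard_iff_nontrivial).1 hXc)
  obtain ⟨v, hv⟩ := hX.exists_connected_induce_compl_singleton_of_finite_nontrivial
  have hsub : X \ {v.1} ⊆ X := Set.sdiff_subset
  refine ih _ ?_ (X := X \ {v.1}) ?_ ?_ rfl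
  · exact Set.ncard_sdiff_singleton_lt_of_mem v.2 (Set.toFinite _)
  · let f : (A.induce X).induce {v}ᶜ →g A.induce (X \ {v.1}) :=
      ⟨fun w ↦ ⟨w.1.1, w.1.2, fun h ↦ w.2 (Subtype.ext h)⟩, fun e ↦ e⟩
    exact hv.map f fun w ↦ ⟨⟨⟨w.1, w.2.1⟩, fun h ↦ w.2.2 (congrArg Subtype.val h)⟩, rfl⟩
  · have := Set.ncard_le_ncard_sdiff_add_ncard (X ∩ W) {v.1} (Set.toFinite _)
    rw [Set.ncard_singleton, Set.inter_sdiff_right_comm] at this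
    omega

lemma exists_isTree_subgraph {G A : SimpleGraph V} (hA : A ≤ G) {X : Set V}
    (hX : (A.induce X).Connected) :
    ∃ T : G.Subgraph, T.verts = X ∧ T.coe.IsTree ∧ T.edgeSet ⊆ A.edgeSet := by
  obtain ⟨T, hle, hT⟩ := hX.exists_isTree_le
  let T' : G.Subgraph :=
    { verts := X
      Adj := fun u v ↦ ∃ hu hv, T.Adj ⟨u, hu⟩ ⟨v, hv⟩
      adj_sub := fun ⟨_, _, e⟩ ↦ hA (hle e)
      edge_vert := fun ⟨hu, _, _⟩ ↦ hu
      symm := ⟨fun _ _ ⟨hu, hv, e⟩ ↦ ⟨hv, hu, e.symm⟩⟩ }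
  have hco : T'.coe = T := by
    ext u v
    exact ⟨fun e ↦ e.choose_spec.choose_spec, fun e ↦ ⟨u.2, v.2, e⟩⟩
  have hadj : ∀ u v, T'.Adj u v → A.Adj u v := fun u v ⟨_, _, e⟩ ↦ hle e
  refine ⟨T', rfl, hco ▸ hT, fun e ↦ ?_⟩
  induction e with | _ u v
  exact hadj u v

lemma two_le_steinerConn [Finite V] {G : SimpleGraph V} {S : Set V} (hS : S.Nontrivial)
    {T₁ T₂ : G.Subgraph} (h₁ : G.IsSteinerTree S T₁) (h₂ : G.IsSteinerTree S T₂)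
    (he : T₁.edgeSet ∩ T₂.edgeSet = ∅) (hv : T₁.verts ∩ T₂.verts = S) :
    2 ≤ G.steinerConn S := by
  refine le_csSup ⟨Nat.card G.Subgraph, ?_⟩ ⟨![T₁, T₂], ?_, ?_⟩
  · rintro n ⟨f, hf, hd⟩
    have hinj : Function.Injective f := by
      intro i j hij
      by_contra hne
      obtain ⟨x, hx, y, hy, hxy⟩ := hS
      have hc := (hf i).2.connected.preconnected ⟨x, (hf i).1 hx⟩ ⟨y, (hf i).1 hy⟩
      obtain ⟨p⟩ := hc
      cases p with
      | nil => exact hxy rfl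
      | @cons _ w _ e p =>
        have := (hd i j hne).1
        rw [← hij, Set.inter_self] at this
        exact (this ▸ (show s(x, w.1) ∈ (f i).edgeSet from e) : s(x, w.1) ∈ (∅ : Set (Sym2 V)))
    simpa using Nat.card_le_card_of_injective f hinj
  · intro i; fin_cases i
    exacts [h₁, h₂]
  · intro i j hij
    fin_cases i <;> fin_cases j
    · exact absurd rfl hij
    · exact ⟨he, hv⟩
    · exact ⟨by rw [Set.inter_comm]; exact he, by rw [Set.inter_comm]; exact hv⟩
    · exact absurd rfl hij

lemma steinerConn_le_kappaBar [Finite V] {G : SimpleGraph V} (S : Finset V) :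
    G.steinerConn ↑S ≤ G.kappaBar S.card := by
  refine le_csSup (Set.Finite.bddAbove ?_) ⟨S, rfl, rfl⟩
  refine (Set.finite_range fun S : Finset V ↦ G.steinerConn ↑S).subset ?_
  rintro m ⟨S, -, rfl⟩
  exact ⟨S, rfl⟩

lemma IsSplitting.two_le_kappaBar [Finite V] {G A B : SimpleGraph V} {r : V}
    (h : G.IsSplitting A B r) {k : ℕ} (hk : 2 ≤ k) (hs : k ≤ (shared A B r).ncard) :
    2 ≤ G.kappaBar k := by
  have conn : ∀ H : SimpleGraph V, (H.induce {v | H.Reachable r v}).Connected := by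
    intro H
    have hsupp : {v | H.Reachable r v} = (H.connectedComponentMk r).supp := by
      ext v
      simp only [Set.mem_ofPred_eq, ConnectedComponent.mem_supp_iff, ConnectedComponent.eq]
      exact ⟨Reachable.symm, Reachable.symm⟩
    rw [hsupp]
    exact (H.connectedComponentMk r).connected_toSimpleGraph
  obtain ⟨X, hX, hc⟩ := exists_connected_induce_ncard_inter_eq
    (W := {v | B.Reachable r v}) (by omega) (conn A) hs
  obtain ⟨T₁, hv₁, ht₁, he₁⟩ := exists_isTree_subgraph
    (G := G) (fun u v e ↦ (h.adj_iff u v).2 (Or.inl e)) hX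
  obtain ⟨T₂, hv₂, ht₂, he₂⟩ := exists_isTree_subgraph
    (G := G) (fun u v e ↦ (h.adj_iff u v).2 (Or.inr e)) (conn B)
  set S := X ∩ {v | B.Reachable r v} with hSdef
  have hS : 2 ≤ G.steinerConn S := by
    refine two_le_steinerConn ((Set.one_lt_ncard_iff_nontrivial).1 (by omega))
      ⟨hv₁ ▸ Set.inter_subset_left, ht₁⟩ ⟨hv₂ ▸ Set.inter_subset_right, ht₂⟩ ?_ (by rw [hv₁, hv₂])
    rw [Set.eq_empty_iff_forall_notMem]
    intro e
    induction e with | _ u v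
    exact fun he ↦ h.disj u v (he₁ he.1) (he₂ he.2)
  have hfin := Set.toFinite S
  have := steinerConn_le_kappaBar (G := G) hfin.toFinset
  rw [hfin.coe_toFinset, ← Set.ncard_eq_toFinset_card S hfin, hc] at this
  exact hS.trans this

/-- Growing a connected vertex set inside a connected graph does not decrease the number of edges
minus the number of vertices. -/
lemma Connected.ncard_add_card_le [Finite V] {G : SimpleGraph V} (hG : G.Connected) {W : Set V}
    {F : Set (Sym2 V)} (hW : W.Nonempty) (hF : F ⊆ G.edgeSet) (hFW : ∀ e ∈ F, ∀ v ∈ e, v ∈ W) :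
    F.ncard + Nat.card V ≤ G.edgeSet.ncard + W.ncard := by
  induction hn : Wᶜ.ncard generalizing W F with
  | zero =>
    have h1 := Set.ncard_add_ncard_compl W
    have h2 := Set.ncard_le_ncard hF (Set.toFinite _)
    omega
  | succ n ih =>
    obtain ⟨u, v, e, hu, hv⟩ : ∃ u v, G.Adj u v ∧ u ∈ W ∧ v ∉ W := by
      by_contra! hcl
      obtain ⟨w, hw⟩ := hW
      obtain ⟨v, hv⟩ : Wᶜ.Nonempty := by
        rw [← Set.ncard_pos (Set.toFinite _)]; omega
      exact hv ((hG.preconnected w v).mem_of_closed hcl hw)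
    have hF' : s(u, v) ∉ F := fun h ↦ hv (hFW _ h v (Sym2.mem_mk_right _ _))
    have := ih (W := insert v W) (F := insert s(u, v) F) (Set.insert_nonempty _ _)
      (Set.insert_subset e hF) ?_ ?_
    · rw [Set.ncard_insert_of_notMem hF', Set.ncard_insert_of_notMem hv] at this
      omega
    · rintro e (rfl | he) w hw
      · rcases Sym2.mem_iff.1 hw with rfl | rfl
        exacts [Or.inr hu, Or.inl rfl]
      · exact Or.inr (hFW e he w hw)
    · have h1 := Set.ncard_add_ncard_compl W
      have h2 := Set.ncard_add_ncard_compl (insert v W)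
      rw [Set.ncard_insert_of_notMem hv] at h2
      omega

lemma Connected.deleteEdges_of_not_isBridge {G : SimpleGraph V} (hG : G.Connected) {e : Sym2 V}
    (he : ¬ G.IsBridge e) : (G.deleteEdges {e}).Connected := by
  induction e with | _ x y
  rw [isBridge_iff, not_not] at he
  have := hG.nonempty
  refine ⟨fun u v ↦ (hG.preconnected u v).of_forall_adj fun u v e ↦ ?_⟩
  by_cases hs : s(u, v) = s(x, y)
  · rcases Sym2.eq_iff.1 hs with ⟨rfl, rfl⟩ | ⟨rfl, rfl⟩
    exacts [he, he.symm]
  · exact Adj.reachable (by simp [e, hs])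

lemma Walk.exists_first_mem {G : SimpleGraph V} {C : Set V} {x y : V} (p : G.Walk y x)
    (hx : x ∈ C) : ∃ z ∈ C, ∃ q : G.Walk y z, ∀ w ∈ q.support, w ∈ C → w = z := by
  induction p with
  | nil => exact ⟨_, hx, .nil, by simp⟩
  | @cons a b _ e p ih =>
    by_cases ha : a ∈ C
    · exact ⟨a, ha, .nil, by simp⟩
    · obtain ⟨z, hz, q, hq⟩ := ih hx
      refine ⟨z, hz, .cons e q, fun w hw hwC ↦ ?_⟩
      rw [support_cons, List.mem_cons] at hw
      rcases hw with rfl | hw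
      exacts [absurd hwC ha, hq w hw hwC]

lemma Connected.exists_isEar {G : SimpleGraph V} (hG : G.Connected) (hb : ∀ e, ¬ G.IsBridge e)
    {s : V} (c : G.Walk s s) {e : Sym2 V} (he : e ∈ G.edgeSet) (hec : e ∉ c.edges) :
    ∃ (u v : V) (p : G.Walk u v), G.IsEar c p ∧ p.edges.Nodup ∧ ∀ e ∈ p.edges, e ∉ c.edges := by
  classical
  obtain ⟨x, y, hxy, hx, hxyc⟩ : ∃ x y, G.Adj x y ∧ x ∈ c.support ∧ s(x, y) ∉ c.edges := by
    by_contra! hcl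
    induction e with | _ a b
    exact hec (hcl a b he ((hG.preconnected s a).mem_of_closed (P := fun v ↦ v ∈ c.support)
      (fun u v e hu ↦ c.snd_mem_support_of_mem_edges (hcl u v e hu)) c.start_mem_support))
  obtain ⟨p₀⟩ := not_not.1 (hb s(x, y))
  obtain ⟨z, hz, q₀, hq₀⟩ := p₀.reverse.exists_first_mem (C := {v | v ∈ c.support}) hx
  set q := q₀.bypass.mapLe (deleteEdges_le (G := G) {s(x, y)}) with hq
  have hpath : q.IsPath := (q₀.bypass_isPath).mapLe _
  have hqs : ∀ w ∈ q.support, w ∈ c.support → w = z := fun w hw hwc ↦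
    hq₀ w (q₀.support_bypass_subset_support (by simpa [hq] using hw)) hwc
  have hxyq : s(x, y) ∉ q.edges := fun h ↦ by
    have : s(x, y) ∈ q₀.bypass.edges := by simpa [hq] using h
    simpa using q₀.bypass.edges_subset_edgeSet this
  have hqc : ∀ e ∈ q.edges, e ∉ c.edges := by
    intro e
    induction e with | _ a b
    intro hq' hc'
    have h1 := hqs a (q.fst_mem_support_of_mem_edges hq') (c.fst_mem_support_of_mem_edges hc')
    have h2 := hqs b (q.snd_mem_support_of_mem_edges hq') (c.snd_mem_support_of_mem_edges hc')
    exact (q.adj_of_mem_edges hq').ne (h1.trans h2.symm)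
  refine ⟨x, z, .cons hxy q, ⟨by simp, hx, hz, by simpa using hpath.support_nodup, ?_, ?_⟩, ?_, ?_⟩
  · by_cases h : x ∈ q.support
    · exact Or.inl (hqs x h hx)
    · exact Or.inr (by simpa using h)
  · intro w hw hwc
    rw [Walk.support_cons, List.mem_cons] at hw
    exact hw.imp id fun hw ↦ hqs w hw hwc
  · rw [Walk.edges_cons, List.nodup_cons]
    exact ⟨hxyq, hpath.isTrail.edges_nodup⟩
  · intro e he
    rw [Walk.edges_cons, List.mem_cons] at he
    rcases he with rfl | he
    exacts [hxyc, hqc e he]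

/-- A bridgeless connected graph of cyclomatic number at most two is a cycle, or a cycle with an
ear. -/
lemma Connected.isCycle_or_isEar [Finite V] [Nontrivial V] {G : SimpleGraph V} (hG : G.Connected)
    (hb : ∀ e, ¬ G.IsBridge e) (hE : G.edgeSet.ncard ≤ Nat.card V + 1) :
    (∃ (x : V) (c : G.Walk x x), c.IsCycle ∧ (∀ v : V, v ∈ c.support) ∧
        G.edgeSet = {e | e ∈ c.edges}) ∨
    (∃ (x : V) (c : G.Walk x x) (u v : V) (p : G.Walk u v), c.IsCycle ∧ G.IsEar c p ∧
        (∀ w : V, w ∈ c.support ∨ w ∈ p.support) ∧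
        G.edgeSet = {e | e ∈ c.edges} ∪ {e | e ∈ p.edges}) := by
  classical
  have hnbr : ∀ v, ∃ w, G.Adj v w := fun v ↦ hG.preconnected.exists_adj_of_nontrivial v
  obtain ⟨a⟩ := hG.nonempty
  obtain ⟨b, hab⟩ := hnbr a
  obtain ⟨s, c, hc, -⟩ := adj_and_reachable_delete_edges_iff_exists_cycle.1
    ⟨hab, not_not.1 (hb s(a, b))⟩
  by_cases hall : ∀ e ∈ G.edgeSet, e ∈ c.edges
  · refine Or.inl ⟨s, c, hc, fun v ↦ ?_, Set.Subset.antisymm hall c.edges_subset_edgeSet⟩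
    obtain ⟨w, hw⟩ := hnbr v
    exact c.fst_mem_support_of_mem_edges (hall s(v, w) hw)
  push Not at hall
  obtain ⟨e, he, hec⟩ := hall
  obtain ⟨u, z, p, hp, hpn, hpc⟩ := hG.exists_isEar hb c he hec
  have hF : {e | e ∈ c.edges} ∪ {e | e ∈ p.edges} ⊆ G.edgeSet :=
    Set.union_subset c.edges_subset_edgeSet p.edges_subset_edgeSet
  by_cases hall : G.edgeSet ⊆ {e | e ∈ c.edges} ∪ {e | e ∈ p.edges}
  · refine Or.inr ⟨s, c, u, z, p, hc, hp, fun v ↦ ?_, hall.antisymm hF⟩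
    obtain ⟨w, hw⟩ := hnbr v
    exact (hall hw).imp c.fst_mem_support_of_mem_edges p.fst_mem_support_of_mem_edges
  obtain ⟨f, hf, hfn⟩ := Set.not_subset.1 hall
  set W : Set V := {v | v ∈ c.support.tail} ∪ ({v | v ∈ p.support.tail} \ {z}) with hW
  have hcW : ∀ v ∈ c.support, v ∈ W := fun v hv ↦ Or.inl (by
    rw [← Walk.cons_tail_support, List.mem_cons] at hv
    rcases hv with rfl | hv
    · exact Walk.end_mem_tail_support hc.not_nil
    · exact hv)
  have hpW : ∀ v ∈ p.support, v ∈ W := fun v hv ↦ by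
    by_cases hvz : v = z
    · exact hcW v (hvz ▸ hp.2.2.1)
    rw [← Walk.cons_tail_support, List.mem_cons] at hv
    rcases hv with rfl | hv
    · exact hcW v hp.2.1
    · exact Or.inr ⟨hv, hvz⟩
  have hFcard : ({e | e ∈ c.edges} ∪ {e | e ∈ p.edges}).ncard = c.length + p.length := by
    have hd : Disjoint {e | e ∈ c.edges} {e | e ∈ p.edges} :=
      Set.disjoint_left.2 fun e h h' ↦ hpc e h' h
    rw [Set.ncard_union_eq hd (Set.toFinite _) (Set.toFinite _),
      List.ncard_setOf_mem hc.edges_nodup, List.ncard_setOf_mem hpn, Walk.length_edges,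
      Walk.length_edges]
  have hWcard : W.ncard + 1 ≤ c.length + p.length := by
    have hz : z ∈ {v | v ∈ p.support.tail} :=
      Walk.end_mem_tail_support (Walk.not_nil_iff_lt_length.2 hp.1)
    have h1 := Set.ncard_sdiff_singleton_add_one hz (Set.toFinite _)
    have h2 := Set.ncard_union_le {v | v ∈ c.support.tail} ({v | v ∈ p.support.tail} \ {z})
    rw [← hW] at h2
    rw [List.ncard_setOf_mem hp.2.2.2.1] at h1
    rw [List.ncard_setOf_mem hc.support_nodup] at h2
    simp only [List.length_tail, Walk.length_support] at h1 h2
    omega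
  have hle := (hG.deleteEdges_of_not_isBridge (hb f)).ncard_add_card_le (W := W)
    (F := {e | e ∈ c.edges} ∪ {e | e ∈ p.edges}) ⟨s, hcW s c.start_mem_support⟩ ?_ ?_
  · have h1 := Set.ncard_sdiff_singleton_add_one hf (Set.toFinite _)
    rw [edgeSet_deleteEdges] at hle
    omega
  · rw [edgeSet_deleteEdges]
    exact fun e he ↦ ⟨hF he, fun h ↦ hfn (Set.mem_singleton_iff.1 h ▸ he)⟩
  · rintro e (he | he) v hv
    · exact hcW v (c.mem_support_of_mem_edges he hv)
    · exact hpW v (p.mem_support_of_mem_edges he hv)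

end SimpleGraph

/-- A connected graph with `κ̄₄(G) = 1` and no cut edge is either a cycle, or
a cycle together with a single ear. -/
theorem stmt_11 {V : Type*} [Fintype V] (G : SimpleGraph V) (hG : G.Connected)
    (hk : G.kappaBar 4 = 1) (hbridge : ∀ e : Sym2 V, ¬ G.IsBridge e) :
    (∃ (x : V) (c : G.Walk x x), c.IsCycle ∧ (∀ v : V, v ∈ c.support) ∧
        G.edgeSet = {e | e ∈ c.edges}) ∨
    (∃ (x : V) (c : G.Walk x x) (u v : V) (p : G.Walk u v), c.IsCycle ∧ G.IsEar c p ∧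
        (∀ w : V, w ∈ c.support ∨ w ∈ p.support) ∧
        G.edgeSet = {e | e ∈ c.edges} ∪ {e | e ∈ p.edges}) := by
  have : Nontrivial V := by
    obtain ⟨S, hS⟩ : ∃ S : Finset V, S.card = 4 := by
      by_contra! h
      simp [kappaBar, h] at hk
    obtain ⟨a, -, b, -, hab⟩ := Finset.one_lt_card.1 (show 1 < S.card by omega)
    exact ⟨a, b, hab⟩
  refine hG.isCycle_or_isEar hbridge ?_
  by_contra h
  obtain ⟨A, B, r, hs, h4⟩ := hG.exists_isSplitting hbridge (by omega)
  have := hs.two_le_kappaBar (by norm_num) h4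
  omega
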